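/- Suppose that every oriented graph H with no source has a 2-kernel of size at most |V(H)|/2. Then every digraph G with no source has a 2-kernel of size at most |V(G)|/2. -/

import Mathlib

/-- There is a directed path (walk) of length at most `k` from `x` to `y`
in the digraph with adjacency relation `E`. -/
def ReachesIn {V : Type*} (E : V → V → Prop) : ℕ → V → V → Prop
  | 0, x, y => x = y
  | k + 1, x, y => x = y ∨ ∃ z, E x z ∧ ReachesIn E k z y

/-- `X` k-covers `Y`: every vertex of `Y` is joined from some vertex of `X`
by a directed path of length at most `k`. -/
def KCovers {V : Type*} (E : V → V → Prop) (k : ℕ) (X Y : Set V) : Prop :=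
  ∀ y ∈ Y, ∃ x ∈ X, ReachesIn E k x y

/-- `X` is a stable set: no edge has both ends in `X`. -/
def StableSet {V : Type*} (E : V → V → Prop) (X : Set V) : Prop :=
  ∀ x ∈ X, ∀ y ∈ X, ¬ E x y

/-- A `k`-kernel: a stable set that k-covers the whole vertex set. -/
def IsKernel {V : Type*} (E : V → V → Prop) (k : ℕ) (X : Set V) : Prop :=
  StableSet E X ∧ KCovers E k X Set.univ

/-- A source: a vertex of in-degree zero. -/
def IsSource {V : Type*} (E : V → V → Prop) (v : V) : Prop := ∀ u, ¬ E u v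

/-- An oriented graph: no loops and no directed cycles of length two. -/
def Oriented {V : Type*} (E : V → V → Prop) : Prop :=
  (∀ v, ¬ E v v) ∧ ∀ u v, E u v → ¬ E v u

/-- The induced subdigraph on a set `S` of vertices. -/
def Induce {V : Type*} (E : V → V → Prop) (S : Set V) : V → V → Prop :=
  fun a b => a ∈ S ∧ b ∈ S ∧ E a b

/-- `E` induces a tournament on `T`: any two distinct vertices of `T` are
joined by exactly one directed edge. -/
def IsTournamentOn {V : Type*} (E : V → V → Prop) (T : Set V) : Prop :=
  ∀ u ∈ T, ∀ v ∈ T, u ≠ v → (E u v ∨ E v u) ∧ ¬ (E u v ∧ E v u)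

/-- The relation `E` is acyclic: there is no directed cycle. -/
def AcyclicRel {V : Type*} (E : V → V → Prop) : Prop :=
  ∀ x y, E x y → ¬ Relation.ReflTransGen E y x

/-- A split of an oriented graph: a partition `(S,T)` of the vertex set
where `S` is stable and `T` induces a tournament. -/
def IsSplit {V : Type*} (E : V → V → Prop) (S T : Set V) : Prop :=
  S ∪ T = Set.univ ∧ Disjoint S T ∧ StableSet E S ∧ IsTournamentOn E T

/-- A break of an oriented graph: a partition `(S,T)` of the vertex set
where `S` induces an acyclic digraph and `T` induces a tournament. -/
def IsBreak {V : Type*} (E : V → V → Prop) (S T : Set V) : Prop :=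
  S ∪ T = Set.univ ∧ Disjoint S T ∧ AcyclicRel (Induce E S) ∧ IsTournamentOn E T

/-- `N⁺_G[X]`: the set of vertices that belong to `X` or have an in-neighbour in `X`. -/
def ClosedOut {V : Type*} (E : V → V → Prop) (X : Set V) : Set V :=
  {v | v ∈ X ∨ ∃ x ∈ X, E x v}

universe u

/-- The vertices lying on a directed cycle of length two. -/
def DigonSet {V : Type*} (E : V → V → Prop) : Set V :=
  {v | ∃ u, E u v ∧ E v u}

/-- The vertex set of the digon unfolding: every vertex on a digon gets a second copy. -/
abbrev UnfoldVertex {V : Type*} (E : V → V → Prop) : Type _ :=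
  V ⊕ {v // v ∈ DigonSet E}

namespace UnfoldVertex

variable {V : Type*} {E : V → V → Prop}

/-- The vertex of which `w` is a copy. -/
def proj (w : UnfoldVertex E) : V := Sum.elim id Subtype.val w

theorem ext {p q : UnfoldVertex E} (h : proj p = proj q)
    (hb : Sum.isRight p = Sum.isRight q) : p = q := by
  rcases p with p | p <;> rcases q with q | q <;> simp_all [proj, Subtype.ext_iff]

theorem exists_copy {v : V} (hv : v ∈ DigonSet E) (b : Bool) :
    ∃ w : UnfoldVertex E, proj w = v ∧ Sum.isRight w = b := by
  cases b
  · exact ⟨Sum.inl v, rfl, rfl⟩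
  · exact ⟨Sum.inr ⟨v, hv⟩, rfl, rfl⟩

/-- The digon unfolding: each digon is replaced by a directed cycle of length four,
oriented with the help of a ranking `r` of the vertices. -/
def Adj (r : V → ℕ) (p q : UnfoldVertex E) : Prop :=
  E (proj p) (proj q) ∧ (proj q ∈ DigonSet E →
    Sum.isRight q = xor (Sum.isRight p) (decide (r (proj q) < r (proj p))))

theorem adj_or_adj {r : V → ℕ} (hr : Function.Injective r) (hirr : ∀ v, ¬ E v v)
    {p q : UnfoldVertex E} (hpq : E (proj p) (proj q)) (hqp : E (proj q) (proj p)) :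
    Adj r p q ∨ Adj r q p := by
  have hne : r (proj p) ≠ r (proj q) := fun h => by
    rw [hr h] at hpq
    exact hirr _ hpq
  by_cases hq : Sum.isRight q = xor (Sum.isRight p) (decide (r (proj q) < r (proj p)))
  · exact Or.inl ⟨hpq, fun _ => hq⟩
  · refine Or.inr ⟨hqp, fun _ => ?_⟩
    rcases lt_or_gt_of_ne hne with h | h
    · simp only [h, h.not_gt, decide_true, decide_false] at hq ⊢
      revert hq
      cases Sum.isRight p <;> cases Sum.isRight q <;> simp
    · simp only [h, h.not_gt, decide_true, decide_false] at hq ⊢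
      revert hq
      cases Sum.isRight p <;> cases Sum.isRight q <;> simp

theorem oriented_adj {r : V → ℕ} (hr : Function.Injective r) (hirr : ∀ v, ¬ E v v) :
    Oriented (Adj (E := E) r) := by
  refine ⟨fun p hp => hirr _ hp.1, fun p q hpq hqp => ?_⟩
  have hne : r (proj p) ≠ r (proj q) := fun h => by
    have := hpq.1
    rw [hr h] at this
    exact hirr _ this
  have h1 := hpq.2 ⟨_, hpq.1, hqp.1⟩
  have h2 := hqp.2 ⟨_, hqp.1, hpq.1⟩
  rcases lt_or_gt_of_ne hne with h | h
  · simp only [h, h.not_gt, decide_true, decide_false] at h1 h2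
    rw [h1] at h2
    revert h2
    cases Sum.isRight p <;> simp
  · simp only [h, h.not_gt, decide_true, decide_false] at h1 h2
    rw [h1] at h2
    revert h2
    cases Sum.isRight p <;> simp

theorem not_isSource_adj (r : V → ℕ) (hns : ∀ v, ¬ IsSource E v)
    (hdig : ∀ u v x, E u v → E v u → E x v → x = u) (w : UnfoldVertex E) :
    ¬ IsSource (Adj r) w := by
  intro hw
  have hv := hns (proj w)
  simp only [IsSource, not_forall, not_not] at hv
  obtain ⟨u, hu⟩ := hv
  by_cases hD : proj w ∈ DigonSet E
  · obtain ⟨x, hx, hx'⟩ := hD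
    obtain rfl := hdig _ _ _ hx hx' hu
    obtain ⟨p, hp, hpb⟩ := exists_copy (E := E) (v := u) ⟨_, hx', hx⟩
      (xor (Sum.isRight w) (decide (r (proj w) < r u)))
    exact hw p ⟨by rwa [hp], fun _ => by simp [hp, hpb]⟩
  · exact hw (Sum.inl u) ⟨hu, fun h => absurd h hD⟩

theorem reachesIn_proj {r : V → ℕ} (k : ℕ) {p q : UnfoldVertex E}
    (h : ReachesIn (Adj r) k p q) : ReachesIn E k (proj p) (proj q) := by
  induction k generalizing p with
  | zero => exact congrArg proj h
  | succ k ih =>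
    rcases h with h | ⟨z, hz, h⟩
    · exact Or.inl (congrArg proj h)
    · exact Or.inr ⟨proj z, hz.1, ih h⟩

theorem stable_proj {r : V → ℕ} (hr : Function.Injective r) (hirr : ∀ v, ¬ E v v)
    (hdig : ∀ u v x, E u v → E v u → E x v → x = u) {K : Set (UnfoldVertex E)}
    (hK : StableSet (Adj r) K) {p q : UnfoldVertex E} (hp : p ∈ K) (hq : q ∈ K) :
    ¬ E (proj p) (proj q) := by
  intro h
  by_cases hD : proj q ∈ DigonSet E
  · obtain ⟨x, hx, hx'⟩ := hD
    rw [← hdig _ _ _ hx hx' h] at hx'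
    exact (adj_or_adj hr hirr h hx').elim (hK p hp q hq) (hK q hq p hp)
  · exact hK p hp q hq ⟨h, fun h' => absurd h' hD⟩

/-- If a 2-kernel of the unfolding misses every copy of one end of a digon, then it contains
both copies of the other end. -/
theorem mem_of_forall_proj_ne {r : V → ℕ}
    (hdig : ∀ u v x, E u v → E v u → E x v → x = u) {K : Set (UnfoldVertex E)}
    (hK : KCovers (Adj r) 2 K Set.univ) {u v : V} (huv : E u v) (hvu : E v u)
    (hv : ∀ q ∈ K, proj q ≠ v) {p : UnfoldVertex E} (hp : proj p = u) : p ∈ K := by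
  obtain ⟨w, hw, hwb⟩ := exists_copy (E := E) (v := v) ⟨u, huv, hvu⟩
    (xor (Sum.isRight p) (decide (r v < r u)))
  have key : ∀ x, Adj r x w → x = p := by
    intro x hx
    have hxu : proj x = u := hdig _ _ _ huv hvu (hw ▸ hx.1)
    have hb := hx.2 (hw ▸ ⟨u, huv, hvu⟩)
    rw [hwb, hw, hxu] at hb
    refine ext (hxu.trans hp.symm) ?_
    simpa using hb.symm
  obtain ⟨x, hx, h⟩ := hK w trivial
  rcases h with rfl | ⟨z, hz, rfl | ⟨y, hy, rfl⟩⟩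
  · exact absurd hw (hv _ hx)
  · rwa [← key _ hz]
  · obtain rfl := key _ hy
    refine absurd (hdig _ _ _ hvu huv ?_) (hv _ hx)
    rw [← hp]
    exact hz.1

end UnfoldVertex

open UnfoldVertex in
/-- The unfolding of a sourceless digraph in which digons have no other incoming edges transfers
small 2-kernels. -/
theorem exists_small_kernel_of_unfold {V : Type*} [Fintype V] {E : V → V → Prop} {r : V → ℕ}
    (hr : Function.Injective r) (hirr : ∀ v, ¬ E v v)
    (hdig : ∀ u v x, E u v → E v u → E x v → x = u)
    [Fintype {v // v ∈ DigonSet E}] {K : Finset (UnfoldVertex E)}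
    (hK : IsKernel (Adj r) 2 (K : Set (UnfoldVertex E)))
    (hcard : 2 * K.card ≤ Fintype.card (UnfoldVertex E)) :
    ∃ L : Finset V, IsKernel E 2 (L : Set V) ∧ 2 * L.card ≤ Fintype.card V := by
  classical
  have hstab : ∀ p ∈ K, ∀ q ∈ K, ¬ E (proj p) (proj q) := fun p hp q hq =>
    stable_proj hr hirr hdig hK.1 hp hq
  have hmiss : ∀ {u v : V}, E u v → E v u → (∀ q ∈ K, proj q ≠ v) →
      ∀ p : UnfoldVertex E, proj p = u → p ∈ K := fun huv hvu hv p hp =>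
    mem_of_forall_proj_ne hdig hK.2 huv hvu hv hp
  have hdouble : ∀ p ∈ K, proj p ∈ DigonSet E → ∀ q, proj q = proj p → q ∈ K := by
    rintro p hp ⟨v, hvp, hpv⟩ q hq
    refine hmiss hpv hvp (fun x hx hxv => ?_) q hq
    subst hxv
    exact hstab p hp x hx hpv
  have hleft : ∀ p ∈ K, proj p ∈ K.toLeft := by
    rintro (v | v) hp
    · exact Finset.mem_toLeft.mpr hp
    · exact Finset.mem_toLeft.mpr (hdouble _ hp v.2 (Sum.inl v) rfl)
  refine ⟨K.toLeft, ⟨fun x hx y hy => ?_, fun v _ => ?_⟩, ?_⟩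
  · exact hstab (Sum.inl x) (by simpa using hx) (Sum.inl y) (by simpa using hy)
  · obtain ⟨x, hx, h⟩ := hK.2 (Sum.inl v) trivial
    exact ⟨proj x, hleft x hx, reachesIn_proj 2 h⟩
  · have hpartner : ∀ v : {v // v ∈ DigonSet E}, ∃ u : {v // v ∈ DigonSet E},
        E u v ∧ E v u := fun ⟨v, u, huv, hvu⟩ => ⟨⟨u, v, hvu, huv⟩, huv, hvu⟩
    choose f hf using hpartner
    have hcompl : (K.toRightᶜ).card ≤ K.toRight.card := by
      refine Finset.card_le_card_of_injOn f (fun v hv => ?_) (fun v _ w _ hvw => ?_)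
      · have hv' : Sum.inr v ∉ K := by simpa using hv
        have : Sum.inr (f v) ∈ K := hmiss (hf v).1 (hf v).2
          (fun q hq hqv => hv' (hdouble q hq (hqv ▸ v.2) _ hqv.symm)) _ rfl
        simpa using this
      · refine Subtype.ext (hdig _ _ _ (hf w).2 (hf w).1 ?_)
        rw [← hvw]
        exact (hf v).2
    have h1 := K.card_toLeft_add_card_toRight
    have h2 := Finset.card_add_card_compl K.toRight
    rw [Fintype.card_sum] at hcard
    omega

/-- Every finite sourceless digraph has a spanning sourceless subgraph with the same underlying
graph in which the ends of a digon have no further in-neighbours. -/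
theorem exists_minimal_sourceless {V : Type*} [Finite V] (E : V → V → Prop)
    (hirr : ∀ v, ¬ E v v) (hns : ∀ v, ¬ IsSource E v) :
    ∃ F : V → V → Prop, (∀ u v, F u v → E u v) ∧ (∀ u v, E u v → F u v ∨ F v u) ∧
      (∀ v, ¬ IsSource F v) ∧ ∀ u v x, F u v → F v u → F x v → x = u := by
  obtain ⟨F, hF, hmin⟩ := (Set.toFinite {F : V → V → Prop | (∀ u v, F u v → E u v) ∧
    (∀ u v, E u v → F u v ∨ F v u) ∧ ∀ v, ¬ IsSource F v}).exists_minimal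
    ⟨E, fun _ _ h => h, fun _ _ h => Or.inl h, hns⟩
  refine ⟨F, hF.1, hF.2.1, hF.2.2, fun u v x huv hvu hxv => ?_⟩
  by_contra hxu
  have hne : u ≠ v := fun h => hirr v (hF.1 v v (h ▸ huv))
  have hle := hmin (y := fun a b => F a b ∧ ¬ (a = u ∧ b = v))
    ⟨fun a b h => hF.1 a b h.1, fun a b hab => ?_, fun y hy => ?_⟩ (fun a b h => h.1) u v huv
  · exact hle.2 ⟨rfl, rfl⟩
  · have := hF.2.1 a b hab
    by_cases h1 : a = u ∧ b = v
    · obtain ⟨rfl, rfl⟩ := h1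
      exact Or.inr ⟨hvu, fun h => hne h.2⟩
    · by_cases h2 : b = u ∧ a = v
      · obtain ⟨rfl, rfl⟩ := h2
        exact Or.inl ⟨hvu, fun h => hne h.2⟩
      · exact this.imp (fun h => ⟨h, h1⟩) (fun h => ⟨h, h2⟩)
  · by_cases hyv : y = v
    · subst hyv
      exact hy x ⟨hxv, fun h => hxu h.1⟩
    · exact hF.2.2 y fun a ha => hy a ⟨ha, fun h => hyv h.2⟩

theorem ReachesIn.mono {V : Type*} {E F : V → V → Prop} (h : ∀ u v, F u v → E u v) (k : ℕ)
    {x y : V} (hxy : ReachesIn F k x y) : ReachesIn E k x y := by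
  induction k generalizing x with
  | zero => exact hxy
  | succ k ih => exact hxy.imp id fun ⟨z, hz, hzy⟩ => ⟨z, h _ _ hz, ih hzy⟩

/-- If every oriented graph with no source has a 2-kernel of size at most half its
number of vertices, then so does every digraph with no source. -/
theorem stmt_14
    (hyp : ∀ (W : Type u) [Fintype W] (F : W → W → Prop), Oriented F →
      (∀ w : W, ¬ IsSource F w) →
      ∃ K : Finset W, IsKernel F 2 (↑K : Set W) ∧ 2 * K.card ≤ Fintype.card W)
    {V : Type u} [Fintype V] (E : V → V → Prop) (hirr : ∀ v, ¬ E v v)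
    (hnosource : ∀ v : V, ¬ IsSource E v) :
    ∃ K : Finset V, IsKernel E 2 (↑K : Set V) ∧ 2 * K.card ≤ Fintype.card V := by
  classical
  obtain ⟨F, hFE, hEF, hns, hdig⟩ := exists_minimal_sourceless E hirr hnosource
  have hirrF : ∀ v, ¬ F v v := fun v h => hirr v (hFE v v h)
  let r : V → ℕ := fun v => Fintype.equivFin V v
  have hr : Function.Injective r := Fin.val_injective.comp (Fintype.equivFin V).injective
  obtain ⟨K, hK, hcard⟩ := hyp (UnfoldVertex F) (UnfoldVertex.Adj r)
    (UnfoldVertex.oriented_adj hr hirrF) (UnfoldVertex.not_isSource_adj r hns hdig)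
  obtain ⟨L, hL, hLcard⟩ := exists_small_kernel_of_unfold hr hirrF hdig hK hcard
  refine ⟨L, ⟨fun x hx y hy hxy => ?_, fun y hy => ?_⟩, hLcard⟩
  · exact (hEF x y hxy).elim (hL.1 x hx y hy) (hL.1 y hy x hx)
  · obtain ⟨x, hx, h⟩ := hL.2 y hy
    exact ⟨x, hx, h.mono hFE 2⟩
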